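/- Let K ≥ 1 and a₁, …, a_K > 0, let S₁, …, S_K be independent real random variables with S_k Gamma(2,a_k)-distributed, and let J be the almost surely unique index maximizing k ↦ γ(2, a_k·S_k). Then E[log(1 + S_J)] = ∑_{k=1}^{K} a_k²·∫₀^∞ log(1+x)·x·e^{-a_k·x}·[γ(2, a_k·x)]^{K-1} dx. (This is the ergodic rate of the CDF-Based User Selection scheme in single-user mode, with a_k = σ̃²/g_k.) -/

import Mathlib

open MeasureTheory ProbabilityTheory Real Set

/-- The Gamma(2, a) law: density `a² · x · e^{-a·x}` on `(0, ∞)` (shape 2, rate `a`). -/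
noncomputable def gammaLaw (a : ℝ) : Measure ℝ :=
  volume.withDensity fun x =>
    ENNReal.ofReal (if 0 < x then a ^ 2 * x * Real.exp (-(a * x)) else 0)

/-- The lower incomplete gamma function with shape 2: `γ(2, z) = 1 - (z+1)·e^{-z}`. -/
noncomputable def lGamma2 (z : ℝ) : ℝ := 1 - (z + 1) * Real.exp (-z)

theorem gammaLaw_eq_withDensity_restrict (a : ℝ) :
    gammaLaw a = (volume.restrict (Ioi 0)).withDensity
      fun x => ENNReal.ofReal (a ^ 2 * x * Real.exp (-(a * x))) := by
  rw [← withDensity_indicator measurableSet_Ioi, gammaLaw]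
  congr 1
  ext x
  by_cases hx : 0 < x <;> simp [indicator, hx]

theorem gammaLaw_eq_gammaMeasure (a : ℝ) : gammaLaw a = gammaMeasure 2 a := by
  rw [gammaLaw, gammaMeasure]
  congr 1
  ext x
  rw [gammaPDF_eq]
  rcases lt_trichotomy x 0 with hx | rfl | hx
  · simp [hx.not_gt, hx.not_ge]
  · norm_num
  · have : (2 : ℝ) - 1 = 1 := by norm_num
    simp [hx, hx.le, this]

theorem isProbabilityMeasure_gammaLaw {a : ℝ} (ha : 0 < a) :
    IsProbabilityMeasure (gammaLaw a) := by
  rw [gammaLaw_eq_gammaMeasure]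
  exact isProbabilityMeasure_gammaMeasure two_pos ha

theorem integral_gammaLaw (a : ℝ) (f : ℝ → ℝ) :
    ∫ x, f x ∂gammaLaw a = ∫ x in Ioi (0 : ℝ), a ^ 2 * x * Real.exp (-(a * x)) * f x := by
  rw [gammaLaw_eq_withDensity_restrict, integral_withDensity_eq_integral_toReal_smul
    (by fun_prop) (by simp)]
  refine setIntegral_congr_fun measurableSet_Ioi fun x (hx : 0 < x) => ?_
  simp only [smul_eq_mul]
  rw [ENNReal.toReal_ofReal (by positivity)]

theorem integrable_log_one_add_gammaLaw {a : ℝ} (ha : 0 < a) :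
    Integrable (fun x => Real.log (1 + x)) (gammaLaw a) := by
  rw [gammaLaw_eq_withDensity_restrict, integrable_withDensity_iff_integrable_smul'
    (by fun_prop) (by simp)]
  have h := (integrableOn_rpow_mul_exp_neg_mul_rpow (p := 1) (s := 2) (by norm_num) one_pos
    ha).const_mul (a ^ 2)
  refine Integrable.mono' h (by fun_prop) ?_
  filter_upwards [ae_restrict_mem measurableSet_Ioi] with x hx
  have hx : 0 < x := hx
  have hl : 0 ≤ Real.log (1 + x) := Real.log_nonneg (by linarith)
  have hl' : Real.log (1 + x) ≤ x := by
    have := Real.log_le_sub_one_of_pos (show 0 < 1 + x by linarith)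
    linarith
  rw [ENNReal.toReal_ofReal (by positivity), smul_eq_mul, Real.norm_of_nonneg (by positivity),
    rpow_one, rpow_two, neg_mul]
  calc a ^ 2 * x * Real.exp (-(a * x)) * Real.log (1 + x)
      ≤ a ^ 2 * x * Real.exp (-(a * x)) * x := by gcongr
    _ = _ := by ring

theorem hasDerivAt_lGamma2 (z : ℝ) : HasDerivAt lGamma2 (z * Real.exp (-z)) z := by
  have h := (((hasDerivAt_id z).add_const 1).mul (hasDerivAt_neg z).exp).const_sub 1
  convert! h using 1
  simp
  ring

theorem measurable_lGamma2 : Measurable lGamma2 := by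
  unfold lGamma2
  fun_prop

theorem lGamma2_zero : lGamma2 0 = 0 := by simp [lGamma2]

theorem strictMonoOn_lGamma2 : StrictMonoOn lGamma2 (Ici 0) := by
  refine strictMonoOn_of_deriv_pos (convex_Ici 0)
    (fun z _ => (hasDerivAt_lGamma2 z).continuousAt.continuousWithinAt) fun z hz => ?_
  rw [interior_Ici] at hz
  have hz : 0 < z := hz
  rw [(hasDerivAt_lGamma2 z).deriv]
  positivity

theorem lGamma2_nonneg {z : ℝ} (hz : 0 ≤ z) : 0 ≤ lGamma2 z := by
  rw [← lGamma2_zero]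
  exact strictMonoOn_lGamma2.monotoneOn self_mem_Ici hz hz

theorem intervalIntegral_gamma_density (a c : ℝ) :
    ∫ x in (0 : ℝ)..c, a ^ 2 * x * Real.exp (-(a * x)) = lGamma2 (a * c) := by
  have hd (x : ℝ) : HasDerivAt (fun x => lGamma2 (a * x)) (a ^ 2 * x * Real.exp (-(a * x))) x := by
    convert! (hasDerivAt_lGamma2 (a * x)).comp x ((hasDerivAt_id x).const_mul a) using 1
    ring
  rw [intervalIntegral.integral_eq_sub_of_hasDerivAt (fun x _ => hd x)
    (Continuous.intervalIntegrable (by fun_prop) _ _)]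
  simp [lGamma2_zero]

/-- The probability integral transform: `γ(2, a·T)` is uniform when `T ~ Gamma(2, a)`. -/
theorem gammaLaw_lGamma2_lt {a z : ℝ} (ha : 0 < a) (hz : 0 < z) :
    gammaLaw a {t | lGamma2 (a * t) < lGamma2 z} = ENNReal.ofReal (lGamma2 z) := by
  have hm : MeasurableSet {t | lGamma2 (a * t) < lGamma2 z} :=
    measurableSet_lt (measurable_lGamma2.comp (measurable_const_mul a)) measurable_const
  have hs : {t | lGamma2 (a * t) < lGamma2 z} ∩ Ioi 0 = Ioo 0 (z / a) := by
    ext t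
    simp only [mem_inter_iff, mem_ofPred_eq, mem_Ioi, mem_Ioo]
    rw [and_comm]
    refine and_congr_right fun ht => ?_
    rw [strictMonoOn_lGamma2.lt_iff_lt (mem_Ici.2 (by positivity)) (mem_Ici.2 hz.le),
      lt_div_iff₀' ha]
  have hi : IntegrableOn (fun x : ℝ => a ^ 2 * x * Real.exp (-(a * x))) (Ioo 0 (z / a)) :=
    ((by fun_prop : Continuous fun x : ℝ => a ^ 2 * x * Real.exp (-(a * x))).integrableOn_Icc
      (a := 0) (b := z / a)).mono_set Ioo_subset_Icc_self
  rw [gammaLaw_eq_withDensity_restrict, withDensity_apply _ hm, Measure.restrict_restrict hm, hs,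
    ← ofReal_integral_eq_lintegral_ofReal hi, ← integral_Ioc_eq_integral_Ioo,
    ← intervalIntegral.integral_of_le (by positivity), intervalIntegral_gamma_density,
    mul_div_cancel₀ _ ha.ne']
  filter_upwards [ae_restrict_mem measurableSet_Ioo] with x hx
  have := hx.1
  simp only [Pi.zero_apply]
  positivity

theorem pi_gammaLaw_forall_lGamma2_lt {n : ℕ} {b : Fin n → ℝ} (hb : ∀ j, 0 < b j) {z : ℝ}
    (hz : 0 < z) :
    (Measure.pi fun j => gammaLaw (b j)).real {t | ∀ j, lGamma2 (b j * t j) < lGamma2 z}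
      = lGamma2 z ^ n := by
  have := fun j => isProbabilityMeasure_gammaLaw (hb j)
  have hs : {t : Fin n → ℝ | ∀ j, lGamma2 (b j * t j) < lGamma2 z}
      = univ.pi fun j => {u | lGamma2 (b j * u) < lGamma2 z} := by
    ext t
    simp
  rw [hs, Measure.real, Measure.pi_pi]
  simp [gammaLaw_lGamma2_lt (hb _) hz, lGamma2_nonneg hz.le]

/-- The realizations in which user `k` is the strict winner. -/
def winSet {K : ℕ} (a : Fin K → ℝ) (k : Fin K) : Set (Fin K → ℝ) :=
  {s | ∀ j, j ≠ k → lGamma2 (a j * s j) < lGamma2 (a k * s k)}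

theorem measurableSet_winSet {K : ℕ} (a : Fin K → ℝ) (k : Fin K) :
    MeasurableSet (winSet a k) := by
  have h (j : Fin K) : Measurable fun s : Fin K → ℝ => lGamma2 (a j * s j) :=
    measurable_lGamma2.comp (by fun_prop)
  simp only [winSet, ofPred_forall]
  exact .iInter fun j => .iInter fun _ => measurableSet_lt (h j) (h k)

theorem integrable_indicator_winSet_log {K : ℕ} {a : Fin K → ℝ} (ha : ∀ k, 0 < a k) (k : Fin K) :
    Integrable ((winSet a k).indicator fun s => Real.log (1 + s k))
      (Measure.pi fun k => gammaLaw (a k)) := by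
  have := fun k => isProbabilityMeasure_gammaLaw (ha k)
  exact (integrable_comp_eval (μ := fun k => gammaLaw (a k)) (i := k)
    (integrable_log_one_add_gammaLaw (ha k))).indicator (measurableSet_winSet a k)

theorem integral_indicator_winSet_log {n : ℕ} {a : Fin (n + 1) → ℝ} (ha : ∀ k, 0 < a k)
    (k : Fin (n + 1)) :
    ∫ s, (winSet a k).indicator (fun s => Real.log (1 + s k)) s
        ∂(Measure.pi fun k => gammaLaw (a k))
      = a k ^ 2 * ∫ x in Ioi (0 : ℝ),
          Real.log (1 + x) * x * Real.exp (-(a k * x)) * lGamma2 (a k * x) ^ n := by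
  have := fun k => isProbabilityMeasure_gammaLaw (ha k)
  have hp := (measurePreserving_piFinSuccAbove (fun k => gammaLaw (a k)) k).symm
  have hi := integrable_indicator_winSet_log ha k
  rw [← hp.integrable_comp_emb (MeasurableEquiv.measurableEmbedding _)] at hi
  rw [← hp.integral_comp']
  refine (integral_prod _ hi).trans ?_
  simp only [Function.comp_apply]
  rw [integral_gammaLaw, ← integral_const_mul]
  refine setIntegral_congr_fun measurableSet_Ioi fun x (hx : 0 < x) => ?_
  have hz : 0 < a k * x := mul_pos (ha k) hx
  have hm : MeasurableSet {t : Fin n → ℝ |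
      ∀ j, lGamma2 (a (k.succAbove j) * t j) < lGamma2 (a k * x)} := by
    simp only [ofPred_forall]
    exact .iInter fun j => measurableSet_lt (measurable_lGamma2.comp (by fun_prop))
      measurable_const
  have hin (t : Fin n → ℝ) :
      (winSet a k).indicator (fun s => Real.log (1 + s k))
          ((MeasurableEquiv.piFinSuccAbove (fun _ => ℝ) k).symm (x, t))
        = {t : Fin n → ℝ | ∀ j, lGamma2 (a (k.succAbove j) * t j) < lGamma2 (a k * x)}.indicator
            (fun _ => Real.log (1 + x)) t := by
    have he : (MeasurableEquiv.piFinSuccAbove (fun _ => ℝ) k).symm (x, t) =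
        Fin.insertNth (α := fun _ => ℝ) k x t := rfl
    rw [he]
    have hmem : Fin.insertNth (α := fun _ => ℝ) k x t ∈ winSet a k ↔
        ∀ j, lGamma2 (a (k.succAbove j) * t j) < lGamma2 (a k * x) := by
      simp [winSet, Fin.forall_iff_succAbove k]
    simp only [indicator, hmem, mem_ofPred_eq, Fin.insertNth_apply_same]
  simp only [hin]
  rw [integral_indicator_const _ hm, pi_gammaLaw_forall_lGamma2_lt (fun j => ha _) hz]
  simp only [smul_eq_mul]
  ring

/-- Ergodic rate of the CDF-based user selection scheme in single-user
mode: `S₁, …, S_K` independent with `S_k ~ Gamma(2, a_k)` (joint law the product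
measure), and `J ω` is almost surely the unique index maximizing `k ↦ γ(2, a_k·S_k ω)`
(every other index gives a strictly smaller value). Then
`E[log(1 + S_J)] = ∑_k a_k²·∫₀^∞ log(1+x)·x·e^{-a_k·x}·[γ(2, a_k·x)]^{K-1} dx`. -/
theorem cus_su_mode_ergodic_rate {Ω : Type*} [MeasurableSpace Ω]
    (μ : Measure Ω) [IsProbabilityMeasure μ]
    (K : ℕ) (hK : 1 ≤ K) (a : Fin K → ℝ) (ha : ∀ k, 0 < a k)
    (S : Fin K → Ω → ℝ) (hSmeas : ∀ k, Measurable (S k))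
    (hlaw : Measure.map (fun ω => (fun k => S k ω)) μ = Measure.pi fun k => gammaLaw (a k))
    (J : Ω → Fin K)
    (hJ : ∀ᵐ ω ∂μ, ∀ k, k ≠ J ω →
      lGamma2 (a k * S k ω) < lGamma2 (a (J ω) * S (J ω) ω)) :
    ∫ ω, Real.log (1 + S (J ω) ω) ∂μ
      = ∑ k : Fin K, (a k) ^ 2 *
          ∫ x in Set.Ioi (0 : ℝ),
            Real.log (1 + x) * x * Real.exp (-(a k * x)) * (lGamma2 (a k * x)) ^ (K - 1) := by
  obtain ⟨n, rfl⟩ : ∃ n, K = n + 1 := ⟨K - 1, by omega⟩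
  have hpt : (fun ω => Real.log (1 + S (J ω) ω)) =ᵐ[μ] fun ω =>
      ∑ k, (winSet a k).indicator (fun s => Real.log (1 + s k)) fun k => S k ω := by
    filter_upwards [hJ] with ω hω
    rw [Finset.sum_eq_single (J ω)]
    · exact (indicator_of_mem (show (fun k => S k ω) ∈ winSet a (J ω) from hω)
        fun s => Real.log (1 + s (J ω))).symm
    · intro k _ hk
      exact indicator_of_notMem (fun h : (fun k => S k ω) ∈ winSet a k =>
        lt_asymm (hω k hk) (h (J ω) hk.symm)) _
    · simp
  have hmS : Measurable fun ω => fun k => S k ω := measurable_pi_lambda _ hSmeas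
  have hint := integrable_indicator_winSet_log ha
  have hsum := integrable_finsetSum Finset.univ fun k _ => hint k
  rw [integral_congr_ae hpt, ← integral_map (f := fun s => ∑ k, (winSet a k).indicator
      (fun s => Real.log (1 + s k)) s) hmS.aemeasurable (by rw [hlaw]; exact hsum.1), hlaw,
    integral_finsetSum _ fun k _ => hint k]
  exact Finset.sum_congr rfl fun k _ => integral_indicator_winSet_log ha k
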